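/- Let n ≥ 2 and let u : ℝⁿ → ℝⁿ be a smooth vector field with compact support. Then 2 ∫_{ℝⁿ} |l(u)|² dμ = ∫_{ℝⁿ} |Du|² dμ + ((n−2)/n) ∫_{ℝⁿ} (e(u))² dμ, and consequently 2 ∫_{ℝⁿ} |l(u)|² dμ ≥ ∫_{ℝⁿ} |Du|² dμ. -/

import Mathlib

open MeasureTheory Finset

/-- Partial derivative `∂ᵢ f` of a scalar function on `ℝⁿ`. -/
noncomputable def pd {n : ℕ} (f : (Fin n → ℝ) → ℝ) (i : Fin n) (x : Fin n → ℝ) : ℝ :=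
  fderiv ℝ f x (Pi.single i 1)

/-- Linearized strain tensor `e_{ij}(u) = (∂ᵢ u_j + ∂ⱼ u_i)/2`. -/
noncomputable def strain {n : ℕ} (u : (Fin n → ℝ) → Fin n → ℝ) (i j : Fin n)
    (x : Fin n → ℝ) : ℝ :=
  (pd (fun y => u y j) i x + pd (fun y => u y i) j x) / 2

/-- The trace `e(u) = Σᵢ ∂ᵢ uᵢ`, i.e. the divergence of `u`. -/
noncomputable def diver {n : ℕ} (u : (Fin n → ℝ) → Fin n → ℝ) (x : Fin n → ℝ) : ℝ :=
  ∑ i, pd (fun y => u y i) i x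

/-- Trace-free part `l_{ij}(u) = e_{ij}(u) − (1/n) e(u) δ_{ij}`. -/
noncomputable def ltf {n : ℕ} (u : (Fin n → ℝ) → Fin n → ℝ) (i j : Fin n)
    (x : Fin n → ℝ) : ℝ :=
  strain u i j x - (1 / (n : ℝ)) * diver u x * (if i = j then 1 else 0)

section PartialDerivatives

variable {n : ℕ} {f g : (Fin n → ℝ) → ℝ}

lemma contDiff_pd (hf : ContDiff ℝ (⊤ : ℕ∞) f) (i : Fin n) :
    ContDiff ℝ (⊤ : ℕ∞) (pd f i) :=
  (hf.fderiv_right (m := (⊤ : ℕ∞)) (by simp)).clm_apply contDiff_const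

lemma hasCompactSupport_pd (hf : HasCompactSupport f) (i : Fin n) :
    HasCompactSupport (pd f i) :=
  hf.fderiv_apply ℝ (Pi.single i 1)

lemma pd_pd_apply (hf : ContDiff ℝ (⊤ : ℕ∞) f) (i j : Fin n) (x : Fin n → ℝ) :
    pd (pd f i) j x = fderiv ℝ (fderiv ℝ f) x (Pi.single j 1) (Pi.single i 1) := by
  have hd : DifferentiableAt ℝ (fderiv ℝ f) x :=
    ((hf.fderiv_right (m := (⊤ : ℕ∞)) (by simp)).differentiable (by simp)) x
  have h := hd.hasFDerivAt.clm_apply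
    (hasFDerivAt_const (Pi.single i 1 : Fin n → ℝ) x)
  change fderiv ℝ (fun y => fderiv ℝ f y (Pi.single i 1)) x (Pi.single j 1) = _
  rw [h.fderiv]
  simp

lemma pd_comm (hf : ContDiff ℝ (⊤ : ℕ∞) f) (i j : Fin n) :
    pd (pd f i) j = pd (pd f j) i := by
  ext x
  rw [pd_pd_apply hf, pd_pd_apply hf]
  exact (hf.contDiffAt.isSymmSndFDerivAt (by
    simpa using WithTop.coe_le_coe.mpr (le_top : (2 : ℕ∞) ≤ ⊤))) _ _

lemma integrable_mul_of_hasCompactSupport_left (hf : ContDiff ℝ (⊤ : ℕ∞) f)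
    (hg : ContDiff ℝ (⊤ : ℕ∞) g) (hfs : HasCompactSupport f) :
    Integrable (fun x => f x * g x) :=
  (hf.continuous.mul hg.continuous).integrable_of_hasCompactSupport hfs.mul_right

lemma integral_mul_pd (hf : ContDiff ℝ (⊤ : ℕ∞) f) (hg : ContDiff ℝ (⊤ : ℕ∞) g)
    (hfs : HasCompactSupport f) (i : Fin n) :
    ∫ x, f x * pd g i x = -∫ x, pd f i x * g x :=
  integral_mul_fderiv_eq_neg_fderiv_mul_of_integrable
    (integrable_mul_of_hasCompactSupport_left (contDiff_pd hf i) hg (hasCompactSupport_pd hfs i))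
    (integrable_mul_of_hasCompactSupport_left hf (contDiff_pd hg i) hfs)
    (integrable_mul_of_hasCompactSupport_left hf hg hfs)
    (fun x _ => hf.differentiable (by simp) x) (fun x _ => hg.differentiable (by simp) x)

lemma integral_pd_mul_pd_comm (hf : ContDiff ℝ (⊤ : ℕ∞) f) (hg : ContDiff ℝ (⊤ : ℕ∞) g)
    (hfs : HasCompactSupport f) (i j : Fin n) :
    ∫ x, pd f i x * pd g j x = ∫ x, pd f j x * pd g i x := by
  have h₁ := integral_mul_pd hf (contDiff_pd hg j) hfs i
  have h₂ := integral_mul_pd hf (contDiff_pd hg i) hfs j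
  rw [pd_comm hg j i] at h₁
  linarith

end PartialDerivatives

lemma two_mul_sum_trace_free_sq {n : ℕ} (hn : n ≠ 0) (a : Fin n → Fin n → ℝ) :
    2 * ∑ i, ∑ j, ((a i j + a j i) / 2 -
        (1 / (n : ℝ)) * (∑ k, a k k) * (if i = j then 1 else 0)) ^ 2 =
      ∑ i, ∑ j, a i j ^ 2 + ∑ i, ∑ j, a i j * a j i - 2 / n * (∑ k, a k k) ^ 2 := by
  have hn' : (n : ℝ) ≠ 0 := Nat.cast_ne_zero.mpr hn
  set t := ∑ k, a k k with ht
  have expand : ∀ i j, ((a i j + a j i) / 2 - (1 / (n : ℝ)) * t * (if i = j then 1 else 0)) ^ 2 =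
      a i j ^ 2 / 4 + a j i ^ 2 / 4 + a i j * a j i / 2 +
        (if i = j then (t / n) ^ 2 - 2 * (t / n) * a i i else 0) := by
    intro i j
    split_ifs with h
    · subst h; ring
    · ring
  have hswap : ∑ i, ∑ j, a j i ^ 2 = ∑ i, ∑ j, a i j ^ 2 := sum_comm
  simp only [expand, sum_add_distrib, ← sum_div, sum_ite_eq, mem_univ, if_true, hswap,
    sum_sub_distrib, ← mul_sum, ← ht, sum_const, card_univ, Fintype.card_fin, nsmul_eq_mul]
  field_simp
  ring

/-- For `n ≥ 2` and a smooth compactly supported vector field `u` on `ℝⁿ`,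
`2∫|l(u)|² = ∫|Du|² + ((n−2)/n)∫(e(u))²`, hence `2∫|l(u)|² ≥ ∫|Du|²`. -/
theorem two_int_ltf_sq_eq (n : ℕ) (hn : 2 ≤ n) (u : (Fin n → ℝ) → Fin n → ℝ)
    (hu : ContDiff ℝ (⊤ : ℕ∞) u) (hsupp : HasCompactSupport u) :
    2 * (∫ x, ∑ i, ∑ j, ltf u i j x ^ 2) =
        (∫ x, ∑ i, ∑ j, pd (fun y => u y j) i x ^ 2) +
          ((n : ℝ) - 2) / n * ∫ x, diver u x ^ 2 ∧
      (∫ x, ∑ i, ∑ j, pd (fun y => u y j) i x ^ 2) ≤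
        2 * ∫ x, ∑ i, ∑ j, ltf u i j x ^ 2 := by
  have hn0 : n ≠ 0 := by omega
  have hn' : (n : ℝ) ≠ 0 := Nat.cast_ne_zero.mpr hn0
  have hc : ∀ i, ContDiff ℝ (⊤ : ℕ∞) (fun y => u y i) := fun i => contDiff_pi.mp hu i
  have hs : ∀ i, HasCompactSupport (fun y => u y i) := fun i =>
    hsupp.comp_left (g := fun v : Fin n → ℝ => v i) rfl
  have hint : ∀ i j k l, Integrable
      (fun x => pd (fun y => u y i) j x * pd (fun y => u y k) l x) := fun i j k l =>
    integrable_mul_of_hasCompactSupport_left (contDiff_pd (hc i) j) (contDiff_pd (hc k) l)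
      (hasCompactSupport_pd (hs i) j)
  have hD : Integrable (fun x => ∑ i, ∑ j, pd (fun y => u y j) i x ^ 2) := by
    simp only [sq]
    exact integrable_finsetSum _ fun i _ => integrable_finsetSum _ fun j _ => hint j i j i
  have hX : Integrable
      (fun x => ∑ i, ∑ j, pd (fun y => u y j) i x * pd (fun y => u y i) j x) :=
    integrable_finsetSum _ fun i _ => integrable_finsetSum _ fun j _ => hint j i i j
  have hdiv : ∀ x, diver u x ^ 2 =
      ∑ i, ∑ j, pd (fun y => u y j) j x * pd (fun y => u y i) i x := fun x => by
    rw [sq, diver, sum_mul_sum, sum_comm]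
  have hE : Integrable (fun x => diver u x ^ 2) := by
    simp only [hdiv]
    exact integrable_finsetSum _ fun i _ => integrable_finsetSum _ fun j _ => hint j j i i
  have hXE : ∫ x, ∑ i, ∑ j, pd (fun y => u y j) i x * pd (fun y => u y i) j x =
      ∫ x, diver u x ^ 2 := by
    simp only [hdiv]
    rw [integral_finsetSum _ fun i _ => integrable_finsetSum _ fun j _ => hint j i i j,
      integral_finsetSum _ fun i _ => integrable_finsetSum _ fun j _ => hint j j i i]
    refine sum_congr rfl fun i _ => ?_
    rw [integral_finsetSum _ fun j _ => hint j i i j, integral_finsetSum _ fun j _ => hint j j i i]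
    exact sum_congr rfl fun j _ => integral_pd_mul_pd_comm (hc j) (hc i) (hs j) i j
  have hpt : ∀ x, 2 * ∑ i, ∑ j, ltf u i j x ^ 2 =
      ∑ i, ∑ j, pd (fun y => u y j) i x ^ 2 +
        ∑ i, ∑ j, pd (fun y => u y j) i x * pd (fun y => u y i) j x -
        2 / n * diver u x ^ 2 := fun x =>
    two_mul_sum_trace_free_sq hn0 fun i j => pd (fun y => u y j) i x
  have heq : 2 * (∫ x, ∑ i, ∑ j, ltf u i j x ^ 2) =
      (∫ x, ∑ i, ∑ j, pd (fun y => u y j) i x ^ 2) +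
        ((n : ℝ) - 2) / n * ∫ x, diver u x ^ 2 := by
    rw [← integral_const_mul]
    simp only [hpt]
    rw [integral_sub (by exact hD.add hX) (hE.const_mul _), integral_add hD hX,
      integral_const_mul, hXE]
    field_simp
    ring
  refine ⟨heq, ?_⟩
  rw [heq]
  have hn2 : (2 : ℝ) ≤ n := by exact_mod_cast hn
  exact le_add_of_nonneg_right (mul_nonneg (div_nonneg (by linarith) (by linarith))
    (integral_nonneg fun x => sq_nonneg _))
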